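/- Let Σ_A be the renewal shift and φ : Σ_A → ℝ a weakly Hölder continuous potential with sup φ < ∞, and let β_c ∈ (0,∞] be such that βφ is positive recurrent for every β ∈ (0,β_c) and βφ is transient for every β > β_c. Then there exists β̃_c ∈ (0,β_c] such that: for every β ∈ (0,β̃_c), every σ-finite Borel measure ν on Σ_A, finite on every cylinder, with L*_{βφ} ν = e^{P_G(βφ)} ν satisfies ν(Σ_A) < ∞; and for every β ∈ (β̃_c, β_c), every nonzero σ-finite Borel measure ν on Σ_A, finite on every cylinder, with L*_{βφ} ν = e^{P_G(βφ)} ν satisfies ν(Σ_A) = ∞. -/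

import Mathlib

open MeasureTheory Filter Topology ENNReal

namespace CMS

/-- A sequence is admissible for the transition matrix `A`. -/
def IsAdm (A : ℕ → ℕ → Bool) (u : ℕ → ℕ) : Prop := ∀ i, A (u i) (u (i + 1)) = true

/-- The one-sided countable topological Markov shift. -/
abbrev Space (A : ℕ → ℕ → Bool) := {u : ℕ → ℕ // IsAdm A u}

/-- The transition matrix has no row and no column identically zero. -/
def NoDegenerate (A : ℕ → ℕ → Bool) : Prop :=
  (∀ i, ∃ j, A i j = true) ∧ (∀ j, ∃ i, A i j = true)

/-- The shift map. -/
def shift {A : ℕ → ℕ → Bool} (x : Space A) : Space A :=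
  ⟨fun i => x.1 (i + 1), fun i => x.2 (i + 1)⟩

/-- Birkhoff (ergodic) sum `φ_n`. -/
noncomputable def birkhoff {A : ℕ → ℕ → Bool} (φ : Space A → ℝ) (n : ℕ) (x : Space A) : ℝ :=
  ∑ i ∈ Finset.range n, φ (shift^[i] x)

/-- The cylinder set determined by a word. -/
def cyl (A : ℕ → ℕ → Bool) (w : List ℕ) : Set (Space A) :=
  {x | ∀ i : Fin w.length, x.1 i = w.get i}

/-- Concatenation of a finite word with a sequence. -/
def concatSeq (w : List ℕ) (u : ℕ → ℕ) : ℕ → ℕ :=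
  fun i => if h : i < w.length then w.get ⟨i, h⟩ else u (i - w.length)

/-- Prepending a single symbol to a sequence. -/
def prependSeq (a : ℕ) (u : ℕ → ℕ) : ℕ → ℕ := fun i => Nat.casesOn i a u

/-- The set of points to which the symbol `a` may be prepended. -/
def admits (A : ℕ → ℕ → Bool) (a : ℕ) : Set (Space A) := {x | A a (x.1 0) = true}

/-- Prepending a symbol to a point of the shift space (identity if not admissible). -/
noncomputable def prep (A : ℕ → ℕ → Bool) (a : ℕ) (x : Space A) : Space A :=
  if h : A a (x.1 0) = true then
    ⟨prependSeq a x.1, by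
      intro i
      cases i with
      | zero => exact h
      | succ j => exact x.2 j⟩
  else x

/-- The measure `ν ⊚ σ`, `ν⊚σ(E) = Σ_a ν(σ(E ∩ [a]))`. -/
noncomputable def circ (A : ℕ → ℕ → Bool) (ν : Measure (Space A)) : Measure (Space A) :=
  Measure.sum fun a : ℕ => (ν.restrict (admits A a)).map (prep A a)

/-- `ν` is `(φ, l)`-conformal: `dν/d(ν⊚σ) = l⁻¹ e^φ`. -/
def Conformal (A : ℕ → ℕ → Bool) (φ : Space A → ℝ) (l : ℝ) (ν : Measure (Space A)) : Prop :=
  ∀ E : Set (Space A), MeasurableSet E →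
    ν E = ∫⁻ x in E, ENNReal.ofReal (l⁻¹ * Real.exp (φ x)) ∂(circ A ν)

/-- The Ruelle transfer operator. -/
noncomputable def ruelle (A : ℕ → ℕ → Bool) (φ f : Space A → ℝ) (x : Space A) : ℝ :=
  ∑' a : ℕ, if A a (x.1 0) = true then Real.exp (φ (prep A a x)) * f (prep A a x) else 0

/-- The Ruelle operator applied to the constant function 1, valued in `ℝ≥0∞`. -/
noncomputable def ruelleOne (A : ℕ → ℕ → Bool) (φ : Space A → ℝ) (x : Space A) : ℝ≥0∞ :=
  ∑' a : ℕ, if A a (x.1 0) = true then ENNReal.ofReal (Real.exp (φ (prep A a x))) else 0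

/-- `L*_φ ν = l ν` : the dual eigenmeasure equation. -/
def DualEigen (A : ℕ → ℕ → Bool) (φ : Space A → ℝ) (l : ℝ) (ν : Measure (Space A)) : Prop :=
  ∀ f : Space A → ℝ, Integrable f ν →
    ∫ x, ruelle A φ f x ∂ν = l * ∫ x, f x ∂ν

/-- The sub-σ-algebra `σ^{-n} 𝓑`. -/
def shiftSigma (A : ℕ → ℕ → Bool) (n : ℕ) : MeasurableSpace (Space A) :=
  MeasurableSpace.comap (shift^[n]) inferInstance

/-- A sub-σ-algebra `m` is compatible with `ν`: the restriction of `ν` to `m` is σ-finite. -/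
def Compatible (A : ℕ → ℕ → Bool) (ν : Measure (Space A))
    (m : MeasurableSpace (Space A)) : Prop :=
  ∃ s : ℕ → Set (Space A), (∀ k, MeasurableSet[m] (s k)) ∧ (∀ k, ν (s k) ≠ ⊤) ∧
    (⋃ k, s k) = Set.univ

open Classical in
/-- Numerator of the DLR kernel: `e^{φ_n(w σ^n x)} 1{w σ^n x ∈ Σ_A}`. -/
noncomputable def dlrNum (A : ℕ → ℕ → Bool) (φ : Space A → ℝ) (w : List ℕ)
    (x : Space A) : ℝ :=
  if h : IsAdm A (concatSeq w ((shift^[w.length] x).1)) then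
    Real.exp (birkhoff φ w.length (⟨concatSeq w ((shift^[w.length] x).1), h⟩ : Space A))
  else 0

/-- Denominator of the DLR kernel: `Σ_{y : σ^n y = σ^n x} e^{φ_n(y)}`. -/
noncomputable def dlrDen (A : ℕ → ℕ → Bool) (φ : Space A → ℝ) (n : ℕ) (x : Space A) : ℝ :=
  ∑' y : {y : Space A // shift^[n] y = shift^[n] x}, Real.exp (birkhoff φ n y.1)

/-- `ν` is a `φ`-DLR measure. -/
def IsDLR (A : ℕ → ℕ → Bool) (φ : Space A → ℝ) (ν : Measure (Space A)) : Prop :=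
  ∀ n : ℕ, 1 ≤ n →
    Compatible A ν (shiftSigma A n) ∧
    ∀ w : List ℕ, w.length = n →
      (ν[Set.indicator (cyl A w) (fun _ => (1 : ℝ))|shiftSigma A n])
        =ᵐ[ν] fun x => dlrNum A φ w x / dlrDen A φ n x

/-- `ν` is non-singular: `ν ∘ σ⁻¹ ∼ ν`. -/
def NonSingular (A : ℕ → ℕ → Bool) (ν : Measure (Space A)) : Prop :=
  ν.map shift ≪ ν ∧ ν ≪ ν.map shift

/-- Conservative non-singular measure. -/
def Conservative (A : ℕ → ℕ → Bool) (ν : Measure (Space A)) : Prop :=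
  NonSingular A ν ∧
    ∀ W : Set (Space A), MeasurableSet W →
      (∀ i j : ℕ, i ≠ j → ν ((shift^[i] ⁻¹' W) ∩ (shift^[j] ⁻¹' W)) = 0) → ν W = 0

/-- The `n`-th variation `Var_n φ`, valued in `ℝ≥0∞`. -/
noncomputable def varn (A : ℕ → ℕ → Bool) (φ : Space A → ℝ) (n : ℕ) : ℝ≥0∞ :=
  ⨆ (x : Space A) (y : Space A) (_ : ∀ i, i < n → x.1 i = y.1 i),
    ENNReal.ofReal |φ x - φ y|

noncomputable def waltersBound (A : ℕ → ℕ → Bool) (φ : Space A → ℝ) (k : ℕ) : ℝ≥0∞ :=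
  ⨆ (n : ℕ) (_ : 1 ≤ n), varn A (birkhoff φ n) (n + k)

/-- The Walters condition. -/
def Walters (A : ℕ → ℕ → Bool) (φ : Space A → ℝ) : Prop :=
  (∀ k, 1 ≤ k → waltersBound A φ k ≠ ⊤) ∧
  Tendsto (waltersBound A φ) atTop (nhds 0)

/-- `φ` is weakly Hölder continuous. -/
def WeaklyHolder (A : ℕ → ℕ → Bool) (φ : Space A → ℝ) : Prop :=
  ∃ H θ : ℝ, 0 < H ∧ θ ∈ Set.Ioo (0 : ℝ) 1 ∧
    ∀ n : ℕ, 2 ≤ n → varn A φ n ≤ ENNReal.ofReal (H * θ ^ n)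

/-- The partition function `Z_n(φ, a)`, valued in `ℝ≥0∞`. -/
noncomputable def Zn (A : ℕ → ℕ → Bool) (φ : Space A → ℝ) (n a : ℕ) : ℝ≥0∞ :=
  ∑' x : {x : Space A // shift^[n] x = x ∧ x.1 0 = a},
    ENNReal.ofReal (Real.exp (birkhoff φ n x.1))

/-- The partition function `Z*_n(φ, a)` over periodic points whose first return to `[a]` is `n`. -/
noncomputable def Znstar (A : ℕ → ℕ → Bool) (φ : Space A → ℝ) (n a : ℕ) : ℝ≥0∞ :=
  ∑' x : {x : Space A // shift^[n] x = x ∧ x.1 0 = a ∧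
      ∀ k, 0 < k → k < n → (shift^[k] x).1 0 ≠ a},
    ENNReal.ofReal (Real.exp (birkhoff φ n x.1))

/-- `P` is the (finite) Gurevich pressure of `φ`. -/
def HasGurevich (A : ℕ → ℕ → Bool) (φ : Space A → ℝ) (P : ℝ) : Prop :=
  ∀ a : ℕ, (cyl A [a]).Nonempty →
    (∀ n, 1 ≤ n → Zn A φ n a ≠ ⊤) ∧
    Tendsto (fun n : ℕ => Real.log (Zn A φ n a).toReal / n) atTop (nhds P)

/-- `φ` is recurrent (with Gurevich pressure `P`). -/
def Recurrent (A : ℕ → ℕ → Bool) (φ : Space A → ℝ) (P : ℝ) : Prop :=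
  ∀ a : ℕ, (cyl A [a]).Nonempty →
    ∑' n : ℕ, ENNReal.ofReal (Real.exp (-((n + 1 : ℕ) : ℝ) * P)) * Zn A φ (n + 1) a = ⊤

/-- `φ` is positive recurrent (with Gurevich pressure `P`). -/
def PosRecurrent (A : ℕ → ℕ → Bool) (φ : Space A → ℝ) (P : ℝ) : Prop :=
  Recurrent A φ P ∧
  ∀ a : ℕ, (cyl A [a]).Nonempty →
    ∑' n : ℕ, ((n + 1 : ℕ) : ℝ≥0∞) *
      ENNReal.ofReal (Real.exp (-((n + 1 : ℕ) : ℝ) * P)) * Znstar A φ (n + 1) a ≠ ⊤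

/-- `φ` is transient (with Gurevich pressure `P`). -/
def Transient (A : ℕ → ℕ → Bool) (φ : Space A → ℝ) (P : ℝ) : Prop :=
  ∀ a : ℕ, (cyl A [a]).Nonempty →
    ∑' n : ℕ, ENNReal.ofReal (Real.exp (-((n + 1 : ℕ) : ℝ) * P)) * Zn A φ (n + 1) a ≠ ⊤

/-- `Σ_A` is topologically mixing. -/
def TopMixing (A : ℕ → ℕ → Bool) : Prop :=
  ∀ a b : ℕ, ∃ N : ℕ, ∀ n, N < n → ∃ x : Space A, x.1 0 = a ∧ (shift^[n] x).1 0 = b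

/-- The big images and preimages (BIP) property. -/
def BIP (A : ℕ → ℕ → Bool) : Prop :=
  ∃ (N : ℕ) (b : Fin N → ℕ), ∀ a : ℕ,
    (∃ i, A (b i) a = true) ∧ (∃ j, A a (b j) = true)

/-- An admissible word. -/
def AdmWord (A : ℕ → ℕ → Bool) (w : List ℕ) : Prop :=
  ∀ (i : ℕ) (h : i + 1 < w.length),
    A (w.get ⟨i, Nat.lt_of_succ_lt h⟩) (w.get ⟨i + 1, h⟩) = true

/-- The image of `E ⊆ [a̲]` under the cylinder-swapping map `v_{a̲,b̲}`. -/
def swapImage (A : ℕ → ℕ → Bool) (b : List ℕ) (E : Set (Space A)) : Set (Space A) :=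
  {y | ∃ x ∈ E, y.1 = concatSeq b ((shift^[b.length] x).1)}

/-- The image of `E` under the prepending map `I_b`. -/
def prepImage (A : ℕ → ℕ → Bool) (b : ℕ) (E : Set (Space A)) : Set (Space A) :=
  {y | ∃ x ∈ E, y.1 = prependSeq b x.1}

/-- The transition matrix of the renewal shift:
`A(1,1) = A(1,i) = A(i,i-1) = 1` (for `i > 1`), all other entries `0`. -/
def renA : ℕ → ℕ → Bool := fun i j => decide ((i = 1 ∧ 1 ≤ j) ∨ (2 ≤ i ∧ j = i - 1))

/-- The transition matrix of the shift `Σ_{𝓡⁻}`: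
`A(i,i+1) = A(i,1) = 1` for `i ≥ 1`, all other entries `0`. -/
def rminusA : ℕ → ℕ → Bool := fun i j => decide (1 ≤ i ∧ (j = i + 1 ∨ j = 1))

/-- The periodic sequence obtained by repeating the word `w`. -/
def perSeq (w : List ℕ) : ℕ → ℕ := fun i => w.getD (i % w.length) 0

/-- The word `(j, j-1, …, 1, n, n-1, …, j+1)`. -/
def gammaWord (j n : ℕ) : List ℕ :=
  ((List.range j).map (· + 1)).reverse ++ ((List.range (n - j)).map (· + (j + 1))).reverse

/-- The point `x̄ = (1, 2, 3, …)` of `Σ_{𝓡⁻}`. -/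
def xbar : Space rminusA := ⟨fun i => i + 1, by intro i; simp [rminusA]⟩

variable {A : ℕ → ℕ → Bool}

theorem iterate_shift_apply (n : ℕ) (x : Space A) (i : ℕ) :
    (shift^[n] x).1 i = x.1 (i + n) := by
  induction n generalizing x with
  | zero => rfl
  | succ n ih =>
    rw [Function.iterate_succ_apply, ih]
    simp [shift, add_assoc]

theorem birkhoff_succ' (ψ : Space A → ℝ) (n : ℕ) (x : Space A) :
    birkhoff ψ (n + 1) x = ψ x + birkhoff ψ n (shift x) := by
  simp [birkhoff, Finset.sum_range_succ', add_comm]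

theorem birkhoff_add (ψ : Space A → ℝ) (j m : ℕ) (x : Space A) :
    birkhoff ψ (j + m) x = birkhoff ψ j x + birkhoff ψ m (shift^[j] x) := by
  simp only [birkhoff, Finset.sum_range_add, ← Function.iterate_add_apply]
  simp only [add_comm]

theorem birkhoff_mul_sub (φ : Space A → ℝ) (β p : ℝ) (n : ℕ) (x : Space A) :
    birkhoff (fun x => β * φ x - p) n x = β * birkhoff φ n x - n * p := by
  simp [birkhoff, Finset.mul_sum]

theorem birkhoff_mul (φ : Space A → ℝ) (β : ℝ) (n : ℕ) (x : Space A) :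
    birkhoff (fun x => β * φ x) n x = β * birkhoff φ n x := by
  simp [birkhoff, Finset.mul_sum]

/-- Birkhoff sums of length `n` differ by at most `D` on cylinders of length `n + 1`. -/
def BoundedDistortion (ψ : Space A → ℝ) (D : ℝ) : Prop :=
  ∀ (n : ℕ) (x y : Space A), (∀ i, i ≤ n → x.1 i = y.1 i) →
    birkhoff ψ n x ≤ birkhoff ψ n y + D

theorem BoundedDistortion.mul_sub {φ : Space A → ℝ} {D : ℝ} (h : BoundedDistortion φ D)
    {β : ℝ} (hβ : 0 ≤ β) (p : ℝ) : BoundedDistortion (fun x => β * φ x - p) (β * D) := by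
  intro n x y hxy
  rw [birkhoff_mul_sub, birkhoff_mul_sub]
  nlinarith [mul_le_mul_of_nonneg_left (h n x y hxy) hβ]

theorem BoundedDistortion.mul {φ : Space A → ℝ} {D : ℝ} (h : BoundedDistortion φ D)
    {β : ℝ} (hβ : 0 ≤ β) : BoundedDistortion (fun x => β * φ x) (β * D) := by
  simpa using h.mul_sub hβ 0

theorem abs_sub_le_of_varn_le {φ : Space A → ℝ} {n : ℕ} {c : ℝ} (hc : 0 ≤ c)
    (h : varn A φ n ≤ ENNReal.ofReal c) {x y : Space A} (hxy : ∀ i, i < n → x.1 i = y.1 i) :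
    |φ x - φ y| ≤ c := by
  rw [← ENNReal.ofReal_le_ofReal_iff hc]
  refine le_trans ?_ h
  exact le_iSup_of_le x (le_iSup_of_le y (le_iSup_of_le hxy le_rfl))

theorem boundedDistortion_of_holder {φ : Space A → ℝ} {H θ : ℝ} (hH : 0 ≤ H) (h0 : 0 < θ)
    (h1 : θ < 1)
    (h : ∀ n, 2 ≤ n → ∀ x y : Space A, (∀ i, i < n → x.1 i = y.1 i) → |φ x - φ y| ≤ H * θ ^ n) :
    BoundedDistortion φ (H / (1 - θ)) := by
  intro n
  suffices ∀ x y : Space A, (∀ i, i ≤ n → x.1 i = y.1 i) →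
      birkhoff φ n x ≤ birkhoff φ n y + H / (1 - θ) * (1 - θ ^ n) by
    intro x y hxy
    refine (this x y hxy).trans ?_
    have : 0 ≤ H / (1 - θ) * θ ^ n := mul_nonneg (div_nonneg hH (by linarith)) (by positivity)
    linarith
  induction n with
  | zero => intro x y _; simp [birkhoff]
  | succ n ih =>
    intro x y hxy
    rw [birkhoff_succ', birkhoff_succ']
    have ha := ih (shift x) (shift y) (fun i hi => hxy (i + 1) (by omega))
    have hb := (abs_le.1 (h (n + 2) (by omega) x y (fun i hi => hxy i (by omega)))).2
    have hc : H / (1 - θ) * (1 - θ ^ (n + 1)) = H / (1 - θ) * (1 - θ ^ n) + H * θ ^ n := by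
      have : 1 - θ ≠ 0 := by linarith
      field_simp
      ring
    have hd : H * θ ^ (n + 2) ≤ H * θ ^ n :=
      mul_le_mul_of_nonneg_left (pow_le_pow_of_le_one h0.le h1.le (by omega)) hH
    linarith

theorem continuous_of_holder {φ : Space A → ℝ} {H θ : ℝ} (h0 : 0 < θ) (h1 : θ < 1)
    (h : ∀ n, 2 ≤ n → ∀ x y : Space A, (∀ i, i < n → x.1 i = y.1 i) → |φ x - φ y| ≤ H * θ ^ n) :
    Continuous φ := by
  rw [continuous_iff_continuousAt]
  intro x
  rw [Metric.continuousAt_iff']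
  intro ε hε
  have ht : Tendsto (fun n : ℕ => H * θ ^ n) atTop (𝓝 (H * 0)) :=
    (tendsto_pow_atTop_nhds_zero_of_lt_one h0.le h1).const_mul H
  rw [mul_zero] at ht
  obtain ⟨n, hn, hn2⟩ := ((ht.eventually (gt_mem_nhds hε)).and (eventually_ge_atTop 2)).exists
  have hopen : ∀ᶠ y : Space A in 𝓝 x, ∀ i ∈ Finset.range n, y.1 i = x.1 i := by
    rw [Filter.eventually_all_finset]
    intro i _
    have hc : Continuous fun y : Space A => y.1 i :=
      (continuous_apply i).comp continuous_subtype_val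
    exact hc.continuousAt.eventually ((isOpen_discrete {x.1 i}).mem_nhds rfl)
  filter_upwards [hopen] with y hy
  rw [Real.dist_eq]
  exact (h n hn2 y x (fun i hi => hy i (Finset.mem_range.2 hi))).trans_lt hn

theorem renA_iff {i j : ℕ} : renA i j = true ↔ (i = 1 ∧ 1 ≤ j) ∨ (2 ≤ i ∧ j = i - 1) := by
  simp [renA]

theorem one_le_coord (x : Space renA) (i : ℕ) : 1 ≤ x.1 i := by
  have := renA_iff.1 (x.2 i)
  omega

/-- The point `(j, j - 1, …, 2, 1, 1, 1, …)`. -/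
def descent (j : ℕ) : Space renA :=
  ⟨fun i => max (j - i) 1, fun i => by
    show renA (max (j - i) 1) (max (j - (i + 1)) 1) = true
    rw [renA_iff]
    omega⟩

theorem coord_eq_sub (x : Space renA) {i : ℕ} (hi : i < x.1 0) : x.1 i = x.1 0 - i := by
  induction i with
  | zero => simp
  | succ i ih =>
    have h1 := ih (by omega)
    have h2 := renA_iff.1 (x.2 i)
    omega

/-- The first `n` symbols of `y` followed by `x`, if admissible. -/
def splice (n : ℕ) (y x : Space A) (h : y.1 n = x.1 0) : Space A :=
  ⟨fun i => if i < n then y.1 i else x.1 (i - n), by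
    intro i
    have hy := y.2 i
    rcases lt_trichotomy (i + 1) n with hi | hi | hi
    · simpa [hi, (by omega : i < n)] using hy
    · subst hi
      simpa [h] using hy
    · have e : i + 1 - n = i - n + 1 := by omega
      simp only [if_neg (by omega : ¬ i + 1 < n), if_neg (by omega : ¬ i < n), e]
      exact x.2 (i - n)⟩

/-- The periodic point repeating the first `n` symbols of `y`. -/
def periodize (n : ℕ) (hn : 0 < n) (y : Space A) (h : y.1 n = y.1 0) : Space A :=
  ⟨fun i => y.1 (i % n), by
    intro i
    have hy := y.2 (i % n)
    have hlt := Nat.mod_lt i hn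
    show A (y.1 (i % n)) (y.1 ((i + 1) % n)) = true
    rcases Nat.lt_or_ge (i % n + 1) n with hi | hi
    · rwa [← Nat.mod_eq_of_lt hi, Nat.mod_add_mod] at hy
    · have e : i % n + 1 = n := by omega
      have e2 : (i + 1) % n = 0 := by rw [← Nat.mod_add_mod, e, Nat.mod_self]
      rw [e2, ← h]
      rwa [e] at hy⟩

theorem iterate_shift_splice (n : ℕ) (y x : Space A) (h : y.1 n = x.1 0) :
    shift^[n] (splice n y x h) = x := by
  apply Subtype.ext
  funext i
  rw [iterate_shift_apply]
  simp [splice]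

theorem splice_apply (n : ℕ) (y x : Space A) (h : y.1 n = x.1 0) {i : ℕ} (hi : i ≤ n) :
    (splice n y x h).1 i = y.1 i := by
  rcases hi.lt_or_eq with hi | rfl
  · simp [splice, hi]
  · simp [splice, h]

theorem iterate_shift_periodize (n : ℕ) (hn : 0 < n) (y : Space A) (h : y.1 n = y.1 0) :
    shift^[n] (periodize n hn y h) = periodize n hn y h := by
  apply Subtype.ext
  funext i
  rw [iterate_shift_apply]
  simp [periodize]

theorem periodize_apply (n : ℕ) (hn : 0 < n) (y : Space A) (h : y.1 n = y.1 0) {i : ℕ}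
    (hi : i ≤ n) : (periodize n hn y h).1 i = y.1 i := by
  rcases hi.lt_or_eq with hi | rfl
  · simp [periodize, Nat.mod_eq_of_lt hi]
  · simp [periodize, h]

/-- The point `(1, m, m - 1, …, 2, x)`, for `x` starting with the symbol `1`. -/
def excursion (m : ℕ) (hm : 0 < m) (x : Space renA) (hx : x.1 0 = 1) : Space renA :=
  ⟨fun i => if i = 0 then 1 else if i < m then m + 1 - i else x.1 (i - m), by
    intro i
    rw [renA_iff]
    have h1 := one_le_coord x
    rcases Nat.lt_or_ge (i + 1) m with hi | hi
    · simp only [Nat.add_eq_zero_iff, one_ne_zero, and_false, if_false, if_pos hi]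
      split_ifs <;> omega
    · have h2 := renA_iff.1 (x.2 (i - m))
      have h3 := h1 (i - m + 1)
      rcases Nat.lt_or_ge i m with hi2 | hi2
      · have e : i + 1 - m = 0 := by omega
        simp only [Nat.add_eq_zero_iff, one_ne_zero, and_false, if_false,
          if_neg (Nat.not_lt.2 hi), e, hx, if_pos hi2]
        split_ifs <;> omega
      · have e : i + 1 - m = i - m + 1 := by omega
        simp only [Nat.add_eq_zero_iff, one_ne_zero, and_false, if_false,
          if_neg (Nat.not_lt.2 hi), e, if_neg (Nat.not_lt.2 hi2)]
        rw [if_neg (by omega)]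
        omega⟩

theorem iterate_shift_excursion (m : ℕ) (hm : 0 < m) (x : Space renA) (hx : x.1 0 = 1) :
    shift^[m] (excursion m hm x hx) = x := by
  apply Subtype.ext
  funext i
  rw [iterate_shift_apply]
  simp [excursion, hm.ne']

theorem excursion_congr (m : ℕ) (hm : 0 < m) (x y : Space renA) (hx : x.1 0 = 1)
    (hy : y.1 0 = 1) {i : ℕ} (hi : i ≤ m) :
    (excursion m hm x hx).1 i = (excursion m hm y hy).1 i := by
  rcases hi.lt_or_eq with hi | rfl
  · simp [excursion, hi]
  · simp [excursion, hx, hy]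

theorem exists_excursion {n : ℕ} {x y : Space renA} (hx : x.1 0 = 1)
    (hy : shift^[n + 1] y = x) (hy0 : y.1 0 = 1) :
    ∃ i j, i + j = n ∧ shift^[j] y = excursion (i + 1) i.succ_pos x hx := by
  have hcoord : ∀ k, y.1 (k + (n + 1)) = x.1 k := fun k => by rw [← hy, iterate_shift_apply]
  have hex : ∃ i, y.1 (n - i) = 1 := ⟨n, by simpa using hy0⟩
  classical
  let i := Nat.find hex
  have hi : y.1 (n - i) = 1 := Nat.find_spec hex
  have hmin : ∀ k, k < i → y.1 (n - k) ≠ 1 := fun k hk => Nat.find_min hex hk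
  have hin : i ≤ n := Nat.find_min' hex (by simpa using hy0)
  have hdesc : ∀ k, k ≤ i → y.1 (n + 1 - k) = k + 1 := by
    intro k hk
    induction k with
    | zero => have := hcoord 0; simp only [zero_add] at this; simp [this, hx]
    | succ k ih =>
      have h1 := ih (by omega)
      have h2 := renA_iff.1 (y.2 (n - k))
      rw [(by omega : n - k + 1 = n + 1 - k), h1] at h2
      have h3 := hmin k (by omega)
      rw [(by omega : n + 1 - (k + 1) = n - k)]
      omega
  refine ⟨i, n - i, by omega, ?_⟩
  apply Subtype.ext
  funext c
  rw [iterate_shift_apply]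
  simp only [excursion]
  split_ifs with h1 h2
  · subst h1; simpa using hi
  · have := hdesc (i + 1 - c) (by omega)
    rw [(by omega : c + (n - i) = n + 1 - (i + 1 - c)), this]
    omega
  · rw [← hcoord]
    exact congrArg y.1 (by omega)

theorem excursion_unique {n : ℕ} {x y : Space renA} (hx : x.1 0 = 1) {i j i' j' : ℕ}
    (h : i + j = n) (h' : i' + j' = n)
    (hy : shift^[j] y = excursion (i + 1) i.succ_pos x hx)
    (hy' : shift^[j'] y = excursion (i' + 1) i'.succ_pos x hx) : ¬ j < j' := by
  intro hlt
  have h1 : y.1 j' = 1 := by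
    have := congrArg (fun z => z.1 0) hy'
    simpa [iterate_shift_apply, excursion] using this
  have h2 := congrArg (fun z => z.1 (j' - j)) hy
  simp only [iterate_shift_apply, excursion] at h2
  rw [if_neg (by omega), if_pos (by omega), Nat.sub_add_cancel hlt.le, h1] at h2
  omega

/-- The points of the renewal shift starting with the symbol `1`. -/
abbrev Base := {x : Space renA // x.1 0 = 1}

/-- The inverse branches of the first return map to the cylinder of the symbol `1`. -/
def branch (i : ℕ) (x : Base) : Base := ⟨excursion (i + 1) i.succ_pos x.1 x.2, rfl⟩

/-- The constant sequence `(1, 1, 1, …)`. -/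
def ones : Base := ⟨descent 1, rfl⟩

/-- The weight of an inverse branch of the first return map. -/
noncomputable def branchWeight (ψ : Space renA → ℝ) (i : ℕ) (x : Base) : ℝ≥0∞ :=
  ENNReal.ofReal (Real.exp (birkhoff ψ (i + 1) (branch i x).1))

/-- The weighted number of preimages of order `n` of `x` which start with the symbol `1`. -/
noncomputable def returnSum (ψ : Space renA → ℝ) (n : ℕ) (x : Base) : ℝ≥0∞ :=
  ∑' y : {y : Space renA | shift^[n] y = x.1 ∧ y.1 0 = 1},
    ENNReal.ofReal (Real.exp (birkhoff ψ n y.1))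

/-- The Green function of the transfer operator relative to the cylinder of the symbol `1`. -/
noncomputable def green (ψ : Space renA → ℝ) (x : Base) : ℝ≥0∞ := ∑' n, returnSum ψ n x

theorem returnSum_zero (ψ : Space renA → ℝ) (x : Base) : returnSum ψ 0 x = 1 := by
  have : {y : Space renA | shift^[0] y = x.1 ∧ y.1 0 = 1} = {x.1} := by
    ext y
    simp only [Function.iterate_zero, id, Set.mem_ofPred_eq, Set.mem_singleton_iff]
    exact ⟨fun h => h.1, fun h => ⟨h, h ▸ x.2⟩⟩
  rw [returnSum, tsum_congr_set_coe (fun y => ENNReal.ofReal (Real.exp (birkhoff ψ 0 y))) this]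
  rw [tsum_singleton x.1 (fun y => ENNReal.ofReal (Real.exp (birkhoff ψ 0 y)))]
  simp [birkhoff]

theorem returnSum_succ (ψ : Space renA → ℝ) (n : ℕ) (x : Base) :
    returnSum ψ (n + 1) x =
      ∑ p ∈ Finset.HasAntidiagonal.antidiagonal n,
        branchWeight ψ p.1 x * returnSum ψ p.2 (branch p.1 x) := by
  have hS : {y : Space renA | shift^[n + 1] y = x.1 ∧ y.1 0 = 1} =
      ⋃ p ∈ Finset.HasAntidiagonal.antidiagonal n,
        {y : Space renA | shift^[p.2] y = (branch p.1 x).1 ∧ y.1 0 = 1} := by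
    ext y
    simp only [Set.mem_ofPred_eq, Set.mem_iUnion, Finset.HasAntidiagonal.mem_antidiagonal,
      exists_prop, Prod.exists]
    constructor
    · rintro ⟨h, h0⟩
      obtain ⟨i, j, hij, hy⟩ := exists_excursion x.2 h h0
      exact ⟨i, j, hij, hy, h0⟩
    · rintro ⟨i, j, hij, hy, h0⟩
      refine ⟨?_, h0⟩
      rw [← hij, add_right_comm, Function.iterate_add_apply, hy]
      exact iterate_shift_excursion _ i.succ_pos x.1 x.2
  have hdisj : Set.PairwiseDisjoint (Finset.HasAntidiagonal.antidiagonal n : Set (ℕ × ℕ))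
      fun p => {y : Space renA | shift^[p.2] y = (branch p.1 x).1 ∧ y.1 0 = 1} := by
    intro p hp q hq hpq
    rw [Finset.mem_coe, Finset.HasAntidiagonal.mem_antidiagonal] at hp hq
    refine Set.disjoint_left.2 fun y hy hy' => ?_
    have h1 := excursion_unique x.2 hp hq hy.1 hy'.1
    have h2 := excursion_unique x.2 hq hp hy'.1 hy.1
    exact hpq (Prod.ext (by omega) (by omega))
  rw [returnSum, tsum_congr_set_coe
    (fun y => ENNReal.ofReal (Real.exp (birkhoff ψ (n + 1) y))) hS,
    Summable.tsum_finset_bUnion_disjoint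
      (f := fun y => ENNReal.ofReal (Real.exp (birkhoff ψ (n + 1) y))) hdisj
      fun _ _ => ENNReal.summable]
  refine Finset.sum_congr rfl fun p hp => ?_
  rw [Finset.HasAntidiagonal.mem_antidiagonal] at hp
  rw [returnSum, ← ENNReal.tsum_mul_left]
  refine tsum_congr fun y => ?_
  rw [branchWeight, ← ENNReal.ofReal_mul (Real.exp_nonneg _), ← Real.exp_add, ← hp,
    (by ring : p.1 + p.2 + 1 = p.2 + (p.1 + 1)), birkhoff_add, y.2.1, add_comm]

theorem tsum_sum_antidiagonal (g : ℕ → ℕ → ℝ≥0∞) :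
    ∑' n, ∑ p ∈ Finset.HasAntidiagonal.antidiagonal n, g p.1 p.2 = ∑' i, ∑' j, g i j := by
  rw [← ENNReal.tsum_prod,
    ← Finset.HasAntidiagonal.sigmaAntidiagonalEquivProd.tsum_eq (fun p : ℕ × ℕ => g p.1 p.2),
    ENNReal.tsum_sigma']
  refine tsum_congr fun n => ?_
  rw [tsum_fintype, ← Finset.sum_coe_sort]
  rfl

theorem green_eq (ψ : Space renA → ℝ) (x : Base) :
    green ψ x = 1 + ∑' i, branchWeight ψ i x * green ψ (branch i x) := by
  rw [green, tsum_eq_zero_add' ENNReal.summable, returnSum_zero]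
  simp only [returnSum_succ, green, ← ENNReal.tsum_mul_left]
  rw [tsum_sum_antidiagonal fun i j => branchWeight ψ i x * returnSum ψ j (branch i x)]

theorem sum_range_succ_returnSum_le (ψ : Space renA → ℝ) (N : ℕ) (x : Base) :
    ∑ n ∈ Finset.range (N + 1), returnSum ψ n x ≤
      1 + ∑' i, branchWeight ψ i x * ∑ n ∈ Finset.range N, returnSum ψ n (branch i x) := by
  rw [Finset.sum_range_succ', returnSum_zero, add_comm]
  gcongr
  let g : ℕ → ℕ → ℝ≥0∞ := fun i j =>
    branchWeight ψ i x * if j ∈ Finset.range N then returnSum ψ j (branch i x) else 0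
  calc ∑ n ∈ Finset.range N, returnSum ψ (n + 1) x
      = ∑ n ∈ Finset.range N, ∑ p ∈ Finset.HasAntidiagonal.antidiagonal n, g p.1 p.2 := by
        refine Finset.sum_congr rfl fun n hn => ?_
        rw [returnSum_succ]
        refine Finset.sum_congr rfl fun p hp => ?_
        rw [Finset.HasAntidiagonal.mem_antidiagonal] at hp
        rw [Finset.mem_range] at hn
        simp only [g]
        rw [if_pos (Finset.mem_range.2 (by omega))]
    _ ≤ ∑' n, ∑ p ∈ Finset.HasAntidiagonal.antidiagonal n, g p.1 p.2 := ENNReal.sum_le_tsum _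
    _ = ∑' i, ∑' j, g i j := tsum_sum_antidiagonal g
    _ = _ := by
        refine tsum_congr fun i => ?_
        rw [ENNReal.tsum_mul_left, tsum_eq_sum (s := Finset.range N) fun j hj => if_neg hj]
        congr 1
        exact Finset.sum_congr rfl fun j hj => if_pos hj

section Distortion

variable {ψ : Space renA → ℝ} {D : ℝ}

theorem ofReal_exp_le {a b D : ℝ} (h : a ≤ b + D) :
    ENNReal.ofReal (Real.exp a) ≤ ENNReal.ofReal (Real.exp D) * ENNReal.ofReal (Real.exp b) := by
  rw [← ENNReal.ofReal_mul (Real.exp_nonneg _), ← Real.exp_add]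
  exact ENNReal.ofReal_le_ofReal (Real.exp_le_exp.2 (by linarith))

theorem returnSum_le (h : BoundedDistortion ψ D) (n : ℕ) (x x' : Base) :
    returnSum ψ n x ≤ ENNReal.ofReal (Real.exp D) * returnSum ψ n x' := by
  have hend : ∀ y : {y : Space renA | shift^[n] y = x.1 ∧ y.1 0 = 1}, y.1.1 n = x'.1.1 0 := by
    intro y
    have := congrArg (fun z => z.1 0) y.2.1
    simp only [iterate_shift_apply, zero_add] at this
    rw [this, x.2, x'.2]
  let F : {y : Space renA | shift^[n] y = x.1 ∧ y.1 0 = 1} →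
      {y : Space renA | shift^[n] y = x'.1 ∧ y.1 0 = 1} := fun y =>
    ⟨splice n y.1 x'.1 (hend y), iterate_shift_splice _ _ _ _,
      by rw [splice_apply _ _ _ _ n.zero_le]; exact y.2.2⟩
  have hF : Function.Injective F := by
    intro y z hyz
    apply Subtype.ext
    apply Subtype.ext
    funext i
    rcases le_or_gt n i with hi | hi
    · have h1 := congrArg (fun w => w.1 (i - n)) (y.2.1.trans z.2.1.symm)
      simpa [iterate_shift_apply, Nat.sub_add_cancel hi] using h1
    · have h1 := congrArg (fun w => w.1.1 i) hyz
      simp only [F] at h1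
      rwa [splice_apply _ _ _ _ hi.le, splice_apply _ _ _ _ hi.le] at h1
  calc returnSum ψ n x
      ≤ ∑' y, ENNReal.ofReal (Real.exp D) *
          ENNReal.ofReal (Real.exp (birkhoff ψ n (F y).1)) :=
        ENNReal.tsum_le_tsum fun y => ofReal_exp_le (h n _ _ fun i hi =>
          (splice_apply _ _ _ (hend y) hi).symm)
    _ = ENNReal.ofReal (Real.exp D) *
          ∑' y, ENNReal.ofReal (Real.exp (birkhoff ψ n (F y).1)) := ENNReal.tsum_mul_left
    _ ≤ _ := by
        gcongr
        exact ENNReal.tsum_comp_le_tsum_of_injective hF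
          fun y => ENNReal.ofReal (Real.exp (birkhoff ψ n y.1))

theorem green_le (h : BoundedDistortion ψ D) (x x' : Base) :
    green ψ x ≤ ENNReal.ofReal (Real.exp D) * green ψ x' := by
  rw [green, green, ← ENNReal.tsum_mul_left]
  exact ENNReal.tsum_le_tsum fun n => returnSum_le h n x x'

theorem branchWeight_le (h : BoundedDistortion ψ D) (i : ℕ) (x x' : Base) :
    branchWeight ψ i x ≤ ENNReal.ofReal (Real.exp D) * branchWeight ψ i x' :=
  ofReal_exp_le (h _ _ _ fun _ hk =>
    excursion_congr _ i.succ_pos x.1 x'.1 x.2 x'.2 hk)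

theorem Zn_one_le (h : BoundedDistortion ψ D) {n : ℕ} (hn : 0 < n) (x : Base) :
    Zn renA ψ n 1 ≤ ENNReal.ofReal (Real.exp D) * returnSum ψ n x := by
  have hend : ∀ y : {y : Space renA // shift^[n] y = y ∧ y.1 0 = 1}, y.1.1 n = x.1.1 0 := by
    intro y
    have := congrArg (fun z => z.1 0) y.2.1
    simp only [iterate_shift_apply, zero_add] at this
    rw [this, x.2, y.2.2]
  let F : {y : Space renA // shift^[n] y = y ∧ y.1 0 = 1} →
      {y : Space renA | shift^[n] y = x.1 ∧ y.1 0 = 1} := fun y =>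
    ⟨splice n y.1 x.1 (hend y), iterate_shift_splice _ _ _ _,
      by rw [splice_apply _ _ _ _ n.zero_le]; exact y.2.2⟩
  have hF : Function.Injective F := by
    intro y z hyz
    have hlow : ∀ i, i ≤ n → y.1.1 i = z.1.1 i := by
      intro i hi
      have h1 := congrArg (fun w => w.1.1 i) hyz
      simp only [F] at h1
      rwa [splice_apply _ _ _ _ hi, splice_apply _ _ _ _ hi] at h1
    apply Subtype.ext
    apply Subtype.ext
    funext i
    induction i using Nat.strong_induction_on with
    | _ i ih =>
      rcases le_or_gt i n with hi | hi
      · exact hlow i hi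
      · have h1 := congrArg (fun w => w.1 (i - n)) y.2.1
        have h2 := congrArg (fun w => w.1 (i - n)) z.2.1
        simp only [iterate_shift_apply, Nat.sub_add_cancel hi.le] at h1 h2
        rw [h1, h2, ih _ (by omega)]
  calc Zn renA ψ n 1
      ≤ ∑' y, ENNReal.ofReal (Real.exp D) *
          ENNReal.ofReal (Real.exp (birkhoff ψ n (F y).1)) :=
        ENNReal.tsum_le_tsum fun y => ofReal_exp_le (h n _ _ fun i hi =>
          (splice_apply _ _ _ (hend y) hi).symm)
    _ = ENNReal.ofReal (Real.exp D) *
          ∑' y, ENNReal.ofReal (Real.exp (birkhoff ψ n (F y).1)) := ENNReal.tsum_mul_left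
    _ ≤ _ := by
        gcongr
        exact ENNReal.tsum_comp_le_tsum_of_injective hF
          fun y => ENNReal.ofReal (Real.exp (birkhoff ψ n y.1))

theorem returnSum_le_Zn_one (h : BoundedDistortion ψ D) {n : ℕ} (hn : 0 < n) (x : Base) :
    returnSum ψ n x ≤ ENNReal.ofReal (Real.exp D) * Zn renA ψ n 1 := by
  have hend : ∀ y : {y : Space renA | shift^[n] y = x.1 ∧ y.1 0 = 1}, y.1.1 n = y.1.1 0 := by
    intro y
    have := congrArg (fun z => z.1 0) y.2.1
    simp only [iterate_shift_apply, zero_add] at this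
    rw [this, x.2, y.2.2]
  let F : {y : Space renA | shift^[n] y = x.1 ∧ y.1 0 = 1} →
      {y : Space renA // shift^[n] y = y ∧ y.1 0 = 1} := fun y =>
    ⟨periodize n hn y.1 (hend y), iterate_shift_periodize _ _ _ _,
      by rw [periodize_apply _ _ _ _ n.zero_le]; exact y.2.2⟩
  have hF : Function.Injective F := by
    intro y z hyz
    apply Subtype.ext
    apply Subtype.ext
    funext i
    rcases le_or_gt n i with hi | hi
    · have h1 := congrArg (fun w => w.1 (i - n)) (y.2.1.trans z.2.1.symm)
      simpa [iterate_shift_apply, Nat.sub_add_cancel hi] using h1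
    · have h1 := congrArg (fun w => w.1.1 i) hyz
      simp only [F] at h1
      rwa [periodize_apply _ _ _ _ hi.le, periodize_apply _ _ _ _ hi.le] at h1
  calc returnSum ψ n x
      ≤ ∑' y, ENNReal.ofReal (Real.exp D) *
          ENNReal.ofReal (Real.exp (birkhoff ψ n (F y).1)) :=
        ENNReal.tsum_le_tsum fun y => ofReal_exp_le (h n _ _ fun i hi =>
          (periodize_apply _ hn _ (hend y) hi).symm)
    _ = ENNReal.ofReal (Real.exp D) *
          ∑' y, ENNReal.ofReal (Real.exp (birkhoff ψ n (F y).1)) := ENNReal.tsum_mul_left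
    _ ≤ _ := by
        gcongr
        exact ENNReal.tsum_comp_le_tsum_of_injective hF
          fun y => ENNReal.ofReal (Real.exp (birkhoff ψ n y.1))

end Distortion

theorem branchWeight_mul (ψ : Space renA → ℝ) (s : ℝ) (i : ℕ) (x : Base) :
    branchWeight (fun y => s * ψ y) i x = branchWeight ψ i x ^ s := by
  rw [branchWeight, branchWeight, birkhoff_mul, ENNReal.ofReal_rpow_of_pos (Real.exp_pos _),
    ← Real.exp_mul, mul_comm s]

theorem returnSum_sub (ψ : Space renA → ℝ) (c : ℝ) (n : ℕ) (x : Base) :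
    returnSum (fun y => ψ y - c) n x =
      ENNReal.ofReal (Real.exp (-(n * c))) * returnSum ψ n x := by
  rw [returnSum, returnSum, ← ENNReal.tsum_mul_left]
  refine tsum_congr fun y => ?_
  rw [← ENNReal.ofReal_mul (Real.exp_nonneg _), ← Real.exp_add]
  have := birkhoff_mul_sub ψ 1 c n y.1
  simp only [one_mul] at this
  rw [this]
  congr 2
  ring

theorem one_le_green (ψ : Space renA → ℝ) (x : Base) : 1 ≤ green ψ x := by
  rw [green_eq]
  exact le_self_add

/-- If the Green function is finite, raising the weights to a power `s > 1` makes it bounded in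
terms of the distortion and of the weights of the two shortest branches only. -/
theorem sum_returnSum_mul_le {ψ : Space renA → ℝ} {D : ℝ} (h : BoundedDistortion ψ D)
    {κ : ℝ≥0∞} (h0 : κ ≤ branchWeight ψ 0 ones) (h1 : κ ≤ branchWeight ψ 1 ones)
    (hG : green ψ ones ≠ ⊤) {s : ℝ} (hs : 1 < s) (N : ℕ) :
    ∑ n ∈ Finset.range N, returnSum (fun y => s * ψ y) n ones ≤
      (1 - (1 - (ENNReal.ofReal (Real.exp D))⁻¹ * κ * (ENNReal.ofReal (Real.exp D))⁻¹) ^ (s - 1))⁻¹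
        * ENNReal.ofReal (Real.exp D) ^ s := by
  set E := ENNReal.ofReal (Real.exp D) with hE
  have hE0 : E ≠ 0 := by simp [hE, Real.exp_pos]
  have hEt : E ≠ ⊤ := ENNReal.ofReal_ne_top
  set δ := E⁻¹ * κ * E⁻¹ with hδ
  set r := (1 - δ) ^ (s - 1) with hr
  have hs0 : 0 ≤ s := by linarith
  have hGt : ∀ x, green ψ x ≠ ⊤ := fun x =>
    ((green_le h x ones).trans_lt (ENNReal.mul_lt_top hEt.lt_top hG.lt_top)).ne
  let a : ℕ → Base → ℝ≥0∞ := fun i x => branchWeight ψ i x * green ψ (branch i x)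
  have hsum : ∀ x, ∑' i, a i x ≤ green ψ x := fun x => by
    rw [green_eq ψ x]; exact le_add_self
  have hinv : ∀ {u v : ℝ≥0∞}, u ≤ E * v → E⁻¹ * u ≤ v := fun {u v} huv =>
    (ENNReal.inv_mul_le_iff hE0 hEt).2 huv
  have hlow : ∀ i, κ ≤ branchWeight ψ i ones → ∀ x, δ * green ψ x ≤ a i x := by
    intro i hi x
    calc δ * green ψ x = (E⁻¹ * κ) * (E⁻¹ * green ψ x) := by rw [hδ]; ring
      _ ≤ a i x := mul_le_mul' (hinv (hi.trans (branchWeight_le h i ones x)))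
          (hinv (green_le h x (branch i x)))
  have hup : ∀ i x, a i x ≤ (1 - δ) * green ψ x := by
    intro i x
    have key : ∀ j, j ≠ i → κ ≤ branchWeight ψ j ones → a i x ≤ (1 - δ) * green ψ x := by
      intro j hj hκj
      have h2 : a i x + a j x ≤ green ψ x := by
        refine le_trans ?_ (hsum x)
        rw [← Finset.sum_pair (f := fun i => a i x) hj.symm]
        exact ENNReal.sum_le_tsum _
      have h3 : δ * green ψ x ≠ ⊤ :=
        (((hlow j hκj x).trans (le_add_self.trans h2)).trans_lt (hGt x).lt_top).ne
      rw [ENNReal.sub_mul fun _ _ => hGt x, one_mul]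
      exact ENNReal.le_sub_of_add_le_right h3 ((add_le_add_right (hlow j hκj x) _).trans h2)
    by_cases hi : i = 0
    · exact key 1 (by omega) h1
    · exact key 0 (by omega) h0
  have hpow : ∀ x, ∑' i, a i x ^ s ≤ r * green ψ x ^ s := by
    intro x
    have hsplit : ∀ u : ℝ≥0∞, u ^ s = u * u ^ (s - 1) := fun u => by
      conv_rhs => rw [← ENNReal.rpow_one u, ← ENNReal.rpow_mul, one_mul]
      rw [← ENNReal.rpow_add_of_nonneg _ _ zero_le_one (by linarith)]
      congr 1
      ring
    calc ∑' i, a i x ^ s ≤ ∑' i, a i x * ((1 - δ) * green ψ x) ^ (s - 1) := by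
          refine ENNReal.tsum_le_tsum fun i => ?_
          rw [hsplit]
          exact mul_le_mul' le_rfl (ENNReal.rpow_le_rpow (hup i x) (by linarith))
      _ ≤ green ψ x * ((1 - δ) * green ψ x) ^ (s - 1) := by
          rw [ENNReal.tsum_mul_right]
          gcongr
          exact hsum x
      _ = r * green ψ x ^ s := by
          rw [ENNReal.mul_rpow_of_nonneg _ _ (by linarith : (0 : ℝ) ≤ s - 1), hsplit (green ψ x)]
          ring
  set C := (1 - r)⁻¹ with hC
  have hCr : C = 1 + C * r := by
    rw [hC, ← ENNReal.tsum_geometric, ← ENNReal.tsum_mul_right]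
    simp only [← pow_succ]
    rw [tsum_eq_zero_add' ENNReal.summable, pow_zero]
  set c := (E * (green ψ ones)⁻¹) ^ s with hc
  have hone : ∀ x, 1 ≤ c * green ψ x ^ s := by
    intro x
    rw [hc, ← ENNReal.mul_rpow_of_nonneg _ _ hs0]
    refine ENNReal.one_le_rpow ?_ (by linarith)
    calc (1 : ℝ≥0∞) = green ψ ones * (green ψ ones)⁻¹ :=
          (ENNReal.mul_inv_cancel (one_le_green ψ ones |>.trans_lt' zero_lt_one).ne' hG).symm
      _ ≤ (E * green ψ x) * (green ψ ones)⁻¹ := by gcongr; exact green_le h _ _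
      _ = _ := by ring
  have hmain : ∀ N x, ∑ n ∈ Finset.range N, returnSum (fun y => s * ψ y) n x ≤
      C * (c * green ψ x ^ s) := by
    intro N
    induction N with
    | zero => intro x; simp
    | succ N ih =>
      intro x
      calc _ ≤ _ := sum_range_succ_returnSum_le _ N x
        _ ≤ 1 + ∑' i, branchWeight ψ i x ^ s * (C * (c * green ψ (branch i x) ^ s)) := by
            gcongr with i
            · rw [branchWeight_mul]
            · exact ih _
        _ = 1 + C * c * ∑' i, a i x ^ s := by
            rw [← ENNReal.tsum_mul_left]
            congr 1
            refine tsum_congr fun i => ?_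
            rw [ENNReal.mul_rpow_of_nonneg _ _ hs0]
            ring
        _ ≤ c * green ψ x ^ s + C * c * (r * green ψ x ^ s) := by
            gcongr
            · exact hone x
            · exact hpow x
        _ = (1 + C * r) * (c * green ψ x ^ s) := by ring
        _ = _ := by rw [← hCr]
  refine (hmain N ones).trans_eq ?_
  rw [hc, ← ENNReal.mul_rpow_of_nonneg _ _ hs0, mul_assoc, ENNReal.inv_mul_cancel
    (one_le_green ψ ones |>.trans_lt' zero_lt_one).ne' hG, mul_one]

/-- A potential of nonpositive pressure becomes transient when multiplied by `s > 1`. -/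
theorem green_mul_ne_top {ψ : Space renA → ℝ} {D : ℝ} (h : BoundedDistortion ψ D)
    (hfin : ∀ η : ℝ, 0 < η → green (fun y => ψ y - η) ones ≠ ⊤) {s : ℝ} (hs : 1 < s) :
    green (fun y => s * ψ y) ones ≠ ⊤ := by
  set E := ENNReal.ofReal (Real.exp D) with hE
  have hE0 : E ≠ 0 := by simp [hE, Real.exp_pos]
  have hEt : E ≠ ⊤ := ENNReal.ofReal_ne_top
  let b : ℕ → ℝ := fun i => birkhoff ψ (i + 1) (branch i ones).1
  set κ := ENNReal.ofReal (Real.exp (min (b 0) (b 1) - 2)) with hκ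
  have hκ0 : κ ≠ 0 := by simp [hκ, Real.exp_pos]
  set B := (1 - (1 - E⁻¹ * κ * E⁻¹) ^ (s - 1))⁻¹ * E ^ s with hB
  have hBt : B ≠ ⊤ := by
    refine ENNReal.mul_ne_top ?_ (ENNReal.rpow_ne_top_of_nonneg (by linarith) hEt)
    rw [ENNReal.inv_ne_top]
    refine (tsub_pos_of_lt (ENNReal.rpow_lt_one (ENNReal.sub_lt_self ENNReal.one_ne_top
      one_ne_zero ?_) (by linarith))).ne'
    simp [hκ0, hEt]
  have hbound : ∀ N, ∑ n ∈ Finset.range N, returnSum (fun y => s * ψ y) n ones ≤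
      ENNReal.ofReal (Real.exp s) * B := by
    intro N
    set η : ℝ := 1 / (N + 1) with hη
    have hηpos : 0 < η := by positivity
    have hη1 : η ≤ 1 := by
      rw [hη, div_le_one (by positivity)]
      linarith [(Nat.cast_nonneg N : (0 : ℝ) ≤ N)]
    have hd : BoundedDistortion (fun y => ψ y - η) D := by
      have := h.mul_sub zero_le_one η
      simpa using this
    have hbirk : ∀ n y, birkhoff (fun y => ψ y - η) n y = birkhoff ψ n y - n * η := fun n y => by
      have := birkhoff_mul_sub ψ 1 η n y
      simpa using this
    have hk : ∀ i, i ≤ 1 → κ ≤ branchWeight (fun y => ψ y - η) i ones := by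
      intro i hi
      refine ENNReal.ofReal_le_ofReal (Real.exp_le_exp.2 ?_)
      rw [hbirk]
      have h2 : min (b 0) (b 1) ≤ b i := by
        interval_cases i
        · exact min_le_left _ _
        · exact min_le_right _ _
      have h3 : ((i + 1 : ℕ) : ℝ) * η ≤ 2 := by
        have : (i : ℝ) ≤ 1 := by exact_mod_cast hi
        push_cast
        nlinarith
      exact sub_le_sub h2 h3
    refine le_trans ?_ (mul_le_mul_right (sum_returnSum_mul_le hd (hk 0 (by norm_num))
      (hk 1 le_rfl) (hfin η hηpos) hs N) _)
    rw [Finset.mul_sum]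
    refine Finset.sum_le_sum fun n hn => ?_
    have e : (fun y => s * (ψ y - η)) = fun y => s * ψ y - s * η := by funext y; ring
    rw [e, returnSum_sub, ← mul_assoc, ← ENNReal.ofReal_mul (Real.exp_nonneg _), ← Real.exp_add]
    refine le_mul_of_one_le_left' ?_
    rw [ENNReal.one_le_ofReal, Real.one_le_exp_iff]
    have hnN : (n : ℝ) ≤ N := by exact_mod_cast (Finset.mem_range.1 hn).le
    have : (n : ℝ) * η ≤ 1 := by
      rw [hη, mul_one_div, div_le_one (by positivity)]
      linarith
    nlinarith
  exact ((ENNReal.tsum_le_of_sum_range_le hbound).trans_lt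
    (ENNReal.mul_lt_top ENNReal.ofReal_lt_top hBt.lt_top)).ne

theorem le_returnSum {ψ : Space renA → ℝ}
    (h0 : ∀ x, ENNReal.ofReal (7 / 10) ≤ branchWeight ψ 0 x)
    (h1 : ∀ x, ENNReal.ofReal (7 / 10) ≤ branchWeight ψ 1 x) (n : ℕ) (x : Base) :
    ENNReal.ofReal (1 / 2 * (6 / 5) ^ n) ≤ returnSum ψ n x := by
  induction n using Nat.strong_induction_on generalizing x with
  | _ n ih =>
    match n, ih with
    | 0, _ =>
      rw [returnSum_zero, ENNReal.ofReal_le_one]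
      norm_num
    | 1, _ =>
      rw [returnSum_succ]
      simp only [Finset.HasAntidiagonal.antidiagonal_zero, Finset.sum_singleton, returnSum_zero,
        mul_one]
      refine le_trans (ENNReal.ofReal_le_ofReal ?_) (h0 x)
      norm_num
    | n + 2, ih =>
      have hsub : ({(0, n + 1), (1, n)} : Finset (ℕ × ℕ)) ⊆
          Finset.HasAntidiagonal.antidiagonal (n + 1) := by
        intro p hp
        simp only [Finset.mem_insert, Finset.mem_singleton] at hp
        rw [Finset.HasAntidiagonal.mem_antidiagonal]
        rcases hp with rfl | rfl <;> simp [add_comm]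
      rw [returnSum_succ]
      refine le_trans ?_ (Finset.sum_le_sum_of_subset hsub)
      rw [Finset.sum_pair (by simp)]
      refine le_trans ?_ (add_le_add
        (mul_le_mul' (h0 x) (ih (n + 1) (by omega) _)) (mul_le_mul' (h1 x) (ih n (by omega) _)))
      rw [← ENNReal.ofReal_mul (by norm_num), ← ENNReal.ofReal_mul (by norm_num),
        ← ENNReal.ofReal_add (by positivity) (by positivity)]
      refine ENNReal.ofReal_le_ofReal ?_
      have : (0 : ℝ) < (6 / 5) ^ n := by positivity
      rw [pow_add, pow_add]
      nlinarith

theorem cyl_one_nonempty : (cyl renA [1]).Nonempty := by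
  refine ⟨descent 1, fun i => ?_⟩
  obtain ⟨_ | i, hi⟩ := i
  · rfl
  · simp at hi

theorem HasGurevich.tsum_ne_top {ψ : Space renA → ℝ} {P q : ℝ} (h : HasGurevich renA ψ P)
    (hq : P < q) :
    ∑' n : ℕ, ENNReal.ofReal (Real.exp (-((n + 1 : ℕ) : ℝ) * q)) * Zn renA ψ (n + 1) 1 ≠ ⊤ := by
  obtain ⟨hfin, ht⟩ := h 1 cyl_one_nonempty
  obtain ⟨r, hr, hrq⟩ := exists_between hq
  have hs : Summable fun n : ℕ =>
      Real.exp (-((n + 1 : ℕ) : ℝ) * q) * (Zn renA ψ (n + 1) 1).toReal := by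
    have hg : Summable fun n : ℕ => Real.exp (r - q) ^ (n + 1) :=
      (summable_nat_add_iff 1).2
        (summable_geometric_of_lt_one (Real.exp_nonneg _) (Real.exp_lt_one_iff.2 (by linarith)))
    refine hg.of_norm_bounded_eventually_nat ?_
    have he := ((tendsto_add_atTop_iff_nat 1).2 ht).eventually (gt_mem_nhds hr)
    filter_upwards [he] with n hn
    have hn1 : (0 : ℝ) < ((n + 1 : ℕ) : ℝ) := by positivity
    rw [Real.norm_of_nonneg (mul_nonneg (Real.exp_nonneg _) ENNReal.toReal_nonneg),
      ← Real.exp_nat_mul]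
    have hZ : (Zn renA ψ (n + 1) 1).toReal ≤ Real.exp (((n + 1 : ℕ) : ℝ) * r) := by
      rw [div_lt_iff₀ hn1] at hn
      refine Real.le_exp_of_log_le ?_
      linarith
    calc _ ≤ Real.exp (-((n + 1 : ℕ) : ℝ) * q) * Real.exp (((n + 1 : ℕ) : ℝ) * r) := by gcongr
      _ = _ := by rw [← Real.exp_add]; congr 1; ring
  convert hs.tsum_ofReal_ne_top using 3 with n
  rw [ENNReal.ofReal_mul (Real.exp_nonneg _), ENNReal.ofReal_toReal (hfin _ (by omega))]

theorem HasGurevich.log_le {ψ : Space renA → ℝ} {P c r : ℝ} (h : HasGurevich renA ψ P)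
    (hc : 0 < c) (hr : 0 < r)
    (hle : ∀ n : ℕ, 1 ≤ n → ENNReal.ofReal (c * r ^ n) ≤ Zn renA ψ n 1) : Real.log r ≤ P := by
  obtain ⟨hfin, ht⟩ := h 1 cyl_one_nonempty
  have hl : Tendsto (fun n : ℕ => Real.log c / (n : ℝ) + Real.log r) atTop
      (𝓝 (0 + Real.log r)) :=
    (tendsto_const_div_atTop_nhds_zero_nat _).add_const _
  rw [zero_add] at hl
  refine le_of_tendsto_of_tendsto hl ht ?_
  filter_upwards [eventually_ge_atTop 1] with n hn
  have hn' : (0 : ℝ) < n := by exact_mod_cast hn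
  have hle' : c * r ^ n ≤ (Zn renA ψ n 1).toReal :=
    (ENNReal.ofReal_le_iff_le_toReal (hfin n hn)).1 (hle n hn)
  have := Real.log_le_log (by positivity) hle'
  rw [Real.log_mul hc.ne' (by positivity), Real.log_pow] at this
  rw [le_div_iff₀ hn', add_mul, div_mul_cancel₀ _ hn'.ne']
  linarith

theorem green_sub_ne_top {ψ : Space renA → ℝ} {D q : ℝ} (h : BoundedDistortion ψ D)
    (hZ : ∑' n : ℕ, ENNReal.ofReal (Real.exp (-((n + 1 : ℕ) : ℝ) * q)) * Zn renA ψ (n + 1) 1 ≠ ⊤) :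
    green (fun y => ψ y - q) ones ≠ ⊤ := by
  rw [green, tsum_eq_zero_add' ENNReal.summable, returnSum_zero]
  refine ENNReal.add_ne_top.2 ⟨ENNReal.one_ne_top, ne_top_of_le_ne_top
    (ENNReal.mul_ne_top (ENNReal.ofReal_ne_top (r := Real.exp D)) hZ) ?_⟩
  rw [← ENNReal.tsum_mul_left]
  refine ENNReal.tsum_le_tsum fun n => ?_
  rw [returnSum_sub, neg_mul, mul_left_comm]
  gcongr
  exact returnSum_le_Zn_one h n.succ_pos ones

theorem tsum_Zn_ne_top {ψ : Space renA → ℝ} {D q : ℝ} (h : BoundedDistortion ψ D)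
    (hG : green (fun y => ψ y - q) ones ≠ ⊤) :
    ∑' n : ℕ, ENNReal.ofReal (Real.exp (-((n + 1 : ℕ) : ℝ) * q)) * Zn renA ψ (n + 1) 1 ≠ ⊤ := by
  rw [green, tsum_eq_zero_add' ENNReal.summable] at hG
  refine ne_top_of_le_ne_top
    (ENNReal.mul_ne_top (ENNReal.ofReal_ne_top (r := Real.exp D)) (ENNReal.add_ne_top.1 hG).2) ?_
  rw [← ENNReal.tsum_mul_left]
  refine ENNReal.tsum_le_tsum fun n => ?_
  rw [returnSum_sub, neg_mul, mul_left_comm]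
  gcongr
  exact Zn_one_le h n.succ_pos ones

/-- Along the recurrent range, `β ↦ P β / β` is strictly decreasing. -/
theorem mul_pressure_lt {φ : Space renA → ℝ} {C β β' P P' : ℝ} (h : BoundedDistortion φ C)
    (hβ : 0 < β) (hlt : β < β') (hP : HasGurevich renA (fun x => β * φ x) P)
    (hr : Recurrent renA (fun x => β' * φ x) P') : β * (P' / β') < P := by
  by_contra! hle
  have hβ' : 0 < β' := hβ.trans hlt
  have hD := h.mul_sub hβ.le (β * (P' / β'))
  have hs : 1 < β' / β := (one_lt_div hβ).2 hlt
  have hfin : ∀ η : ℝ, 0 < η →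
      green (fun y => (fun x => β * φ x - β * (P' / β')) y - η) ones ≠ ⊤ := by
    intro η hη
    have := green_sub_ne_top (h.mul hβ.le)
      (hP.tsum_ne_top (q := β * (P' / β') + η) (by linarith))
    convert this using 2
    funext y
    ring
  have hG := green_mul_ne_top hD hfin hs
  have e : (fun y => β' / β * (fun x => β * φ x - β * (P' / β')) y)
      = fun y => (fun x => β' * φ x) y - P' := by
    funext y
    field_simp
  rw [e] at hG
  exact tsum_Zn_ne_top (h.mul hβ'.le) hG (hr 1 cyl_one_nonempty)

/-- The Birkhoff sum of `φ` from the point `(n + 1, n, …)` down to `(1, 1, …)`. -/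
def tailSum (φ : Space renA → ℝ) (n : ℕ) : ℝ := ∑ j ∈ Finset.range n, φ (descent (j + 2))

theorem summable_tail_of_lt {φ : Space renA → ℝ} {C β β' P P' : ℝ} (h : BoundedDistortion φ C)
    (hβ : 0 < β) (hlt : β < β') (hP : HasGurevich renA (fun x => β * φ x) P)
    (hr : Recurrent renA (fun x => β' * φ x) P')
    (hs : Summable fun n : ℕ => Real.exp (β' * tailSum φ n - n * P')) :
    Summable fun n : ℕ => Real.exp (β * tailSum φ n - n * P) := by
  have hβ' : 0 < β' := hβ.trans hlt
  have hc := mul_pressure_lt h hβ hlt hP hr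
  have hg : Summable fun n : ℕ => Real.exp (β * (P' / β') - P) ^ n :=
    summable_geometric_of_lt_one (Real.exp_nonneg _) (Real.exp_lt_one_iff.2 (by linarith))
  refine hg.of_norm_bounded_eventually_nat ?_
  filter_upwards [hs.tendsto_atTop_zero.eventually (gt_mem_nhds one_pos)] with n hn
  rw [Real.norm_of_nonneg (Real.exp_nonneg _), ← Real.exp_nat_mul]
  refine Real.exp_le_exp.2 ?_
  rw [Real.exp_lt_one_iff] at hn
  have e : β * tailSum φ n - n * P =
      β / β' * (β' * tailSum φ n - n * P') + n * (β * (P' / β') - P) := by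
    field_simp
    ring
  have : β / β' * (β' * tailSum φ n - n * P') ≤ 0 :=
    mul_nonpos_of_nonneg_of_nonpos (by positivity) hn.le
  linarith

theorem exists_summable_tail {φ : Space renA → ℝ} {C : ℝ} (h : BoundedDistortion φ C)
    (hsup : BddAbove (Set.range φ)) {P : ℝ → ℝ}
    (hP : ∀ β : ℝ, 0 < β → HasGurevich renA (fun x => β * φ x) (P β)) :
    ∃ β₀ : ℝ, 0 < β₀ ∧ ∀ β : ℝ, 0 < β → β ≤ β₀ →
      Summable fun n : ℕ => Real.exp (β * tailSum φ n - n * P β) := by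
  obtain ⟨B, hB⟩ := hsup
  have hφ : ∀ x, φ x ≤ B := fun x => hB ⟨x, rfl⟩
  let b : ℕ → ℝ := fun i => birkhoff φ (i + 1) (branch i ones).1
  set M := |b 0| + |b 1| + |C| with hM
  have hM0 : 0 ≤ M := by positivity
  have hl : 0 < Real.log (10 / 7) := Real.log_pos (by norm_num)
  have hl' : 0 < Real.log (6 / 5) := Real.log_pos (by norm_num)
  have hlow : ∀ i, i = 0 ∨ i = 1 → ∀ x : Base, -M ≤ birkhoff φ (i + 1) (branch i x).1 := by
    intro i hi x
    have h1 := h (i + 1) (branch i ones).1 (branch i x).1 fun _ hk =>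
      excursion_congr _ i.succ_pos ones.1 x.1 ones.2 x.2 hk
    have h2 : -(|b 0| + |b 1|) ≤ b i := by
      have h0 := neg_abs_le (b 0)
      have h1 := neg_abs_le (b 1)
      rcases hi with rfl | rfl <;> linarith [abs_nonneg (b 0), abs_nonneg (b 1)]
    have h3 : b i ≤ birkhoff φ (i + 1) (branch i x).1 + C := h1
    linarith [le_abs_self C]
  refine ⟨min (Real.log (10 / 7) / (M + 1)) (Real.log (6 / 5) / (|B| + 1)), by positivity,
    fun β hβ hle => ?_⟩
  have hβM : β * (M + 1) ≤ Real.log (10 / 7) :=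
    (le_div_iff₀ (by positivity)).1 (hle.trans (min_le_left _ _))
  have hβB : β * (|B| + 1) ≤ Real.log (6 / 5) :=
    (le_div_iff₀ (by positivity)).1 (hle.trans (min_le_right _ _))
  have hw : ∀ i, i = 0 ∨ i = 1 → ∀ x : Base,
      ENNReal.ofReal (7 / 10) ≤ branchWeight (fun x => β * φ x) i x := by
    intro i hi x
    refine ENNReal.ofReal_le_ofReal ?_
    rw [birkhoff_mul, ← Real.exp_log (by norm_num : (0 : ℝ) < 7 / 10), Real.exp_le_exp,
      show (7 / 10 : ℝ) = (10 / 7)⁻¹ by norm_num, Real.log_inv]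
    nlinarith [hlow i hi x]
  have hlogP : Real.log (6 / 5) ≤ P β := by
    refine (hP β hβ).log_le (c := (Real.exp (β * C))⁻¹ * (1 / 2)) (by positivity) (by norm_num)
      fun n hn => ?_
    have h1 := (le_returnSum (hw 0 (Or.inl rfl)) (hw 1 (Or.inr rfl)) n ones).trans
      (returnSum_le_Zn_one (h.mul hβ.le) hn ones)
    rw [mul_assoc, ENNReal.ofReal_mul (by positivity), ENNReal.ofReal_inv_of_pos (Real.exp_pos _),
      ← ENNReal.div_eq_inv_mul]
    exact ENNReal.div_le_of_le_mul' h1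
  have hg : Summable fun n : ℕ => Real.exp (β * B - P β) ^ n :=
    summable_geometric_of_lt_one (Real.exp_nonneg _)
      (Real.exp_lt_one_iff.2 (by nlinarith [le_abs_self B]))
  refine Summable.of_nonneg_of_le (fun _ => Real.exp_nonneg _) (fun n => ?_) hg
  rw [← Real.exp_nat_mul]
  refine Real.exp_le_exp.2 ?_
  have : tailSum φ n ≤ n * B := by
    have := Finset.sum_le_card_nsmul (Finset.range n) (fun j => φ (descent (j + 2))) B
      fun j _ => hφ _
    simpa [tailSum] using this
  nlinarith

/-- The points starting with the symbol `j`. -/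
def symb (j : ℕ) : Set (Space renA) := {x | x.1 0 = j}

theorem cyl_singleton (j : ℕ) : cyl renA [j] = symb j := by
  ext x
  refine ⟨fun h => h ⟨0, by simp⟩, fun h i => ?_⟩
  obtain ⟨_ | i, hi⟩ := i
  · exact h
  · simp at hi

theorem measurable_coord (i : ℕ) : Measurable fun x : Space A => x.1 i :=
  (measurable_pi_apply i).comp measurable_subtype_coe

theorem measurableSet_symb (j : ℕ) : MeasurableSet (symb j) :=
  measurable_coord 0 (measurableSet_singleton j)

theorem iUnion_symb : ⋃ n : ℕ, symb (n + 1) = Set.univ := by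
  refine Set.eq_univ_of_forall fun x => Set.mem_iUnion.2 ⟨x.1 0 - 1, ?_⟩
  have := one_le_coord x 0
  show x.1 0 = x.1 0 - 1 + 1
  omega

theorem measure_univ_eq_tsum (ν : Measure (Space renA)) :
    ν Set.univ = ∑' n : ℕ, ν (symb (n + 1)) := by
  rw [← iUnion_symb, measure_iUnion _ fun n => measurableSet_symb _]
  intro m n hmn
  refine Set.disjoint_left.2 fun x hm hn => hmn ?_
  have h1 : x.1 0 = m + 1 := hm
  have h2 : x.1 0 = n + 1 := hn
  omega

theorem prep_coe {a : ℕ} {x : Space A} (h : A a (x.1 0) = true) :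
    (prep A a x).1 = prependSeq a x.1 := by
  rw [prep, dif_pos h]

theorem measurable_prep (a : ℕ) : Measurable (prep A a) := by
  refine Measurable.subtype_mk (f := fun x => (prep A a x).1) ?_
  refine measurable_pi_iff.2 fun i => ?_
  have e : (fun x : Space A => (prep A a x).1 i) = fun x =>
      if A a (x.1 0) = true then prependSeq a x.1 i else x.1 i := by
    funext x
    split_ifs with h
    · rw [prep_coe h]
    · rw [prep, dif_neg h]
  rw [e]
  refine Measurable.ite ?_ ?_ (measurable_coord i)
  · exact measurable_coord 0 (MeasurableSet.of_discrete (s := {k | A a k = true}))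
  · cases i with
    | zero => exact measurable_const
    | succ i => exact measurable_coord i

theorem ruelle_indicator_symb (ψ : Space renA → ℝ) {j : ℕ} (hj : 1 ≤ j) :
    ruelle renA ψ ((symb (j + 1)).indicator fun _ => 1) =
      (symb j).indicator fun x => Real.exp (ψ (prep renA (j + 1) x)) := by
  funext x
  rw [ruelle, tsum_eq_single (j + 1)]
  · have hiff : renA (j + 1) (x.1 0) = true ↔ x ∈ symb j := by
      rw [renA_iff]
      show _ ↔ x.1 0 = j
      omega
    by_cases h : x ∈ symb j
    · have hmem : prep renA (j + 1) x ∈ symb (j + 1) := by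
        show (prep renA (j + 1) x).1 0 = j + 1
        rw [prep_coe (hiff.2 h)]
        rfl
      rw [if_pos (hiff.2 h), Set.indicator_of_mem h, Set.indicator_of_mem hmem, mul_one]
    · rw [if_neg (mt hiff.1 h), Set.indicator_of_notMem h]
  · intro a ha
    split_ifs with h
    · have hmem : prep renA a x ∉ symb (j + 1) := by
        intro hm
        have hm' : (prep renA a x).1 0 = j + 1 := hm
        rw [prep_coe h] at hm'
        exact ha hm'
      rw [Set.indicator_of_notMem hmem, mul_zero]
    · rfl

theorem prep_eq_descent {j : ℕ} {x : Space renA} (hj : 1 ≤ j) (hx : x ∈ symb j) {i : ℕ}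
    (hi : i < j + 1) : (prep renA (j + 1) x).1 i = (descent (j + 1)).1 i := by
  have hx0 : x.1 0 = j := hx
  rw [prep_coe (renA_iff.2 (by omega))]
  cases i with
  | zero => simp [prependSeq, descent]
  | succ i =>
    have := coord_eq_sub x (i := i) (by omega)
    simp only [prependSeq, descent]
    omega

theorem measureReal_symb_succ {ψ : Space renA → ℝ} (hψ : Continuous ψ) {l e : ℝ}
    {ν : Measure (Space renA)} (hν : DualEigen renA ψ l ν) {j : ℕ} (hj : 1 ≤ j)
    (hfin : ∀ k, ν (symb k) ≠ ⊤)
    (he : ∀ x : Space renA, (∀ i, i < j + 1 → x.1 i = (descent (j + 1)).1 i) →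
      |ψ x - ψ (descent (j + 1))| ≤ e) :
    Real.exp (ψ (descent (j + 1)) - e) * ν.real (symb j) ≤ l * ν.real (symb (j + 1)) ∧
      l * ν.real (symb (j + 1)) ≤ Real.exp (ψ (descent (j + 1)) + e) * ν.real (symb j) := by
  have hf : Integrable ((symb (j + 1)).indicator fun _ => (1 : ℝ)) ν :=
    (integrable_indicator_iff (measurableSet_symb _)).2 (integrableOn_const (hfin _))
  have h := hν _ hf
  rw [ruelle_indicator_symb ψ hj, integral_indicator (measurableSet_symb _),
    integral_indicator (measurableSet_symb _), setIntegral_const, smul_eq_mul, mul_one] at h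
  have hb : ∀ x ∈ symb j, |ψ (prep renA (j + 1) x) - ψ (descent (j + 1))| ≤ e :=
    fun x hx => he _ fun i hi => prep_eq_descent hj hx hi
  have hm : Measurable fun x => Real.exp (ψ (prep renA (j + 1) x)) :=
    Real.measurable_exp.comp (hψ.measurable.comp (measurable_prep _))
  have hgint : IntegrableOn (fun x => Real.exp (ψ (prep renA (j + 1) x))) (symb j) ν := by
    refine Measure.integrableOn_of_bounded (M := Real.exp (ψ (descent (j + 1)) + e)) (hfin j)
      hm.aestronglyMeasurable ?_
    filter_upwards [ae_restrict_mem (measurableSet_symb j)] with x hx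
    rw [Real.norm_of_nonneg (Real.exp_nonneg _), Real.exp_le_exp]
    linarith [(abs_le.1 (hb x hx)).2]
  have hc : ∀ c : ℝ, c * ν.real (symb j) = ∫ _ in symb j, c ∂ν := by
    intro c
    rw [setIntegral_const, smul_eq_mul, mul_comm]
  rw [← h, hc, hc]
  refine ⟨setIntegral_mono_on (integrableOn_const (hfin j)) hgint (measurableSet_symb j) ?_,
    setIntegral_mono_on hgint (integrableOn_const (hfin j)) (measurableSet_symb j) ?_⟩
  · intro x hx
    rw [Real.exp_le_exp]
    linarith [(abs_le.1 (hb x hx)).1]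
  · intro x hx
    rw [Real.exp_le_exp]
    linarith [(abs_le.1 (hb x hx)).2]

/-- The masses of the cylinders of length one are comparable to the weights of the tails. -/
theorem measureReal_symb {φ : Space renA → ℝ} {H θ : ℝ} (hH : 0 ≤ H) (h0 : 0 < θ) (h1 : θ < 1)
    (h : ∀ n, 2 ≤ n → ∀ x y : Space renA, (∀ i, i < n → x.1 i = y.1 i) →
      |φ x - φ y| ≤ H * θ ^ n) {β p : ℝ} (hβ : 0 < β)
    {ν : Measure (Space renA)} (hν : DualEigen renA (fun x => β * φ x) (Real.exp p) ν)
    (hfin : ∀ k, ν (symb k) ≠ ⊤) (n : ℕ) :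
    Real.exp (-(β * (H / (1 - θ)))) * Real.exp (β * tailSum φ n - n * p) * ν.real (symb 1) ≤
        ν.real (symb (n + 1)) ∧
      ν.real (symb (n + 1)) ≤
        Real.exp (β * (H / (1 - θ))) * Real.exp (β * tailSum φ n - n * p) * ν.real (symb 1) := by
  have hstep : ∀ n : ℕ,
      Real.exp (β * (tailSum φ (n + 1) - tailSum φ n) - p - β * (H * θ ^ n)) * ν.real (symb (n + 1))
        ≤ ν.real (symb (n + 2)) ∧ ν.real (symb (n + 2)) ≤
      Real.exp (β * (tailSum φ (n + 1) - tailSum φ n) - p + β * (H * θ ^ n)) *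
        ν.real (symb (n + 1)) := by
    intro n
    have hd : tailSum φ (n + 1) - tailSum φ n = φ (descent (n + 2)) := by
      simp [tailSum, Finset.sum_range_succ]
    obtain ⟨ha, hb⟩ := measureReal_symb_succ (e := β * (H * θ ^ n))
      ((continuous_of_holder h0 h1 h).const_mul β) hν (j := n + 1) (by omega) hfin
      fun x hx => by
        rw [← mul_sub, abs_mul, abs_of_pos hβ]
        refine mul_le_mul_of_nonneg_left ((h (n + 2) (by omega) _ _ hx).trans ?_) hβ.le
        exact mul_le_mul_of_nonneg_left (pow_le_pow_of_le_one h0.le h1.le (by omega)) hH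
    rw [hd]
    have e1 : ∀ a : ℝ, Real.exp (a - p) = (Real.exp p)⁻¹ * Real.exp a := fun a => by
      rw [Real.exp_sub, div_eq_inv_mul]
    rw [show β * φ (descent (n + 2)) - p - β * (H * θ ^ n) =
        β * φ (descent (n + 2)) - β * (H * θ ^ n) - p by ring,
      show β * φ (descent (n + 2)) - p + β * (H * θ ^ n) =
        β * φ (descent (n + 2)) + β * (H * θ ^ n) - p by ring, e1, e1, mul_assoc, mul_assoc]
    exact ⟨(inv_mul_le_iff₀ (Real.exp_pos p)).2 ha, (le_inv_mul_iff₀ (Real.exp_pos p)).2 hb⟩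
  have hgeo : ∀ n : ℕ, H / (1 - θ) * (1 - θ ^ n) + H * θ ^ n = H / (1 - θ) * (1 - θ ^ (n + 1)) := by
    intro n
    have : 1 - θ ≠ 0 := by linarith
    field_simp
    ring
  have key : ∀ n : ℕ,
      Real.exp (β * tailSum φ n - n * p - β * (H / (1 - θ) * (1 - θ ^ n))) * ν.real (symb 1) ≤
        ν.real (symb (n + 1)) ∧
      ν.real (symb (n + 1)) ≤
        Real.exp (β * tailSum φ n - n * p + β * (H / (1 - θ) * (1 - θ ^ n))) *
          ν.real (symb 1) := by
    intro n
    induction n with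
    | zero => simp [tailSum]
    | succ n ih =>
      obtain ⟨ha, hb⟩ := hstep n
      constructor
      · refine le_trans (le_of_eq ?_)
          ((mul_le_mul_of_nonneg_left ih.1 (Real.exp_nonneg _)).trans ha)
        rw [← mul_assoc (Real.exp _) (Real.exp _), ← Real.exp_add, ← hgeo]
        congr 2
        push_cast
        ring
      · refine (hb.trans (mul_le_mul_of_nonneg_left ih.2 (Real.exp_nonneg _))).trans (le_of_eq ?_)
        rw [← mul_assoc (Real.exp _) (Real.exp _), ← Real.exp_add, ← hgeo]
        congr 2
        push_cast
        ring
  have hK : β * (H / (1 - θ) * (1 - θ ^ n)) ≤ β * (H / (1 - θ)) := by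
    refine mul_le_mul_of_nonneg_left ?_ hβ.le
    have : 0 ≤ H / (1 - θ) * θ ^ n := mul_nonneg (div_nonneg hH (by linarith)) (by positivity)
    linarith
  obtain ⟨ha, hb⟩ := key n
  rw [← Real.exp_add, ← Real.exp_add]
  exact ⟨le_trans (mul_le_mul_of_nonneg_right (Real.exp_le_exp.2 (by linarith))
      measureReal_nonneg) ha, hb.trans (mul_le_mul_of_nonneg_right
      (Real.exp_le_exp.2 (by linarith)) measureReal_nonneg)⟩

/-- An eigenmeasure is finite as soon as the weights of the tails are summable, and conversely
unless it vanishes. -/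
theorem measure_univ_ne_top_iff {φ : Space renA → ℝ} {H θ : ℝ} (hH : 0 ≤ H) (h0 : 0 < θ)
    (h1 : θ < 1)
    (h : ∀ n, 2 ≤ n → ∀ x y : Space renA, (∀ i, i < n → x.1 i = y.1 i) →
      |φ x - φ y| ≤ H * θ ^ n) {β p : ℝ} (hβ : 0 < β)
    {ν : Measure (Space renA)} (hν : DualEigen renA (fun x => β * φ x) (Real.exp p) ν)
    (hfin : ∀ w : List ℕ, w ≠ [] → ν (cyl renA w) ≠ ⊤) :
    ν Set.univ ≠ ⊤ ↔ ν = 0 ∨ Summable fun n : ℕ => Real.exp (β * tailSum φ n - n * p) := by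
  have hfin' : ∀ k, ν (symb k) ≠ ⊤ := fun k => cyl_singleton k ▸ hfin [k] (by simp)
  have hm := measureReal_symb hH h0 h1 h hβ hν hfin'
  have hsum : ν Set.univ = ∑' n : ℕ, ENNReal.ofReal (ν.real (symb (n + 1))) := by
    rw [measure_univ_eq_tsum]
    exact tsum_congr fun n => (ofReal_measureReal (hfin' _)).symm
  constructor
  · intro hne
    by_cases hz : ν.real (symb 1) = 0
    · left
      rw [← Measure.measure_univ_eq_zero, hsum, ENNReal.tsum_eq_zero]
      intro n
      have := (hm n).2
      rw [hz, mul_zero] at this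
      exact ENNReal.ofReal_of_nonpos this
    · right
      have hz' : 0 < ν.real (symb 1) := lt_of_le_of_ne measureReal_nonneg (Ne.symm hz)
      have hs : Summable fun n : ℕ => ν.real (symb (n + 1)) := by
        have := ENNReal.summable_toReal (hsum ▸ hne)
        simpa only [ENNReal.toReal_ofReal measureReal_nonneg] using this
      refine Summable.of_nonneg_of_le (fun _ => Real.exp_nonneg _) (fun n => ?_)
        (hs.mul_left (Real.exp (-(β * (H / (1 - θ)))) * ν.real (symb 1))⁻¹)
      rw [le_inv_mul_iff₀ (by positivity)]
      linarith [(hm n).1]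
  · rintro (rfl | hs)
    · simp
    · rw [hsum]
      refine Summable.tsum_ofReal_ne_top (Summable.of_nonneg_of_le (fun _ => measureReal_nonneg)
        (fun n => (hm n).2) ?_)
      exact (hs.mul_left _).mul_right _

theorem statement12 (φ : Space renA → ℝ)
    (hH : WeaklyHolder renA φ) (hsup : BddAbove (Set.range φ))
    (βc : ℝ≥0∞) (hβc : 0 < βc)
    (P : ℝ → ℝ)
    (hP : ∀ β : ℝ, 0 < β → HasGurevich renA (fun x => β * φ x) (P β))
    (hrec : ∀ β : ℝ, 0 < β → ENNReal.ofReal β < βc →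
      PosRecurrent renA (fun x => β * φ x) (P β))
    (htr : ∀ β : ℝ, βc < ENNReal.ofReal β →
      Transient renA (fun x => β * φ x) (P β)) :
    ∃ βt : ℝ≥0∞, 0 < βt ∧ βt ≤ βc ∧
      (∀ β : ℝ, 0 < β → ENNReal.ofReal β < βt →
        ∀ ν : Measure (Space renA), SigmaFinite ν →
          (∀ w : List ℕ, w ≠ [] → ν (cyl renA w) ≠ ⊤) →
          DualEigen renA (fun x => β * φ x) (Real.exp (P β)) ν →
          ν Set.univ ≠ ⊤) ∧
      (∀ β : ℝ, βt < ENNReal.ofReal β → ENNReal.ofReal β < βc →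
        ∀ ν : Measure (Space renA), ν ≠ 0 → SigmaFinite ν →
          (∀ w : List ℕ, w ≠ [] → ν (cyl renA w) ≠ ⊤) →
          DualEigen renA (fun x => β * φ x) (Real.exp (P β)) ν →
          ν Set.univ = ⊤) := by
  obtain ⟨H, θ, hHpos, ⟨h0, h1⟩, hvar⟩ := hH
  have h : ∀ n, 2 ≤ n → ∀ x y : Space renA, (∀ i, i < n → x.1 i = y.1 i) →
      |φ x - φ y| ≤ H * θ ^ n := fun n hn x y hxy =>
    abs_sub_le_of_varn_le (by positivity) (hvar n hn) hxy
  have hD := boundedDistortion_of_holder hHpos.le h0 h1 h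
  let S : Set ℝ≥0∞ := {b | ∃ β : ℝ, 0 < β ∧ ENNReal.ofReal β < βc ∧
    (Summable fun n : ℕ => Real.exp (β * tailSum φ n - n * P β)) ∧ b = ENNReal.ofReal β}
  refine ⟨sSup S, ?_, sSup_le ?_, ?_, ?_⟩
  · obtain ⟨β₀, hβ₀, hsm⟩ := exists_summable_tail hD hsup hP
    obtain ⟨c, hc0, hc⟩ := ENNReal.lt_iff_exists_nnreal_btwn.1 hβc
    have hc0' : (0 : ℝ) < c := by exact_mod_cast hc0
    have hb : 0 < min β₀ c := lt_min hβ₀ hc0'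
    refine (ENNReal.ofReal_pos.2 hb).trans_le (le_sSup ⟨min β₀ c, hb, ?_, ?_, rfl⟩)
    · refine lt_of_le_of_lt (ENNReal.ofReal_le_ofReal (min_le_right _ _)) ?_
      rwa [ENNReal.ofReal_coe_nnreal]
    · exact hsm _ hb (min_le_left _ _)
  · rintro _ ⟨β, _, hlt, _, rfl⟩
    exact hlt.le
  · intro β hβ hlt ν _ hfin hν
    obtain ⟨_, ⟨β', hβ', hβc', hs, rfl⟩, hlt'⟩ := lt_sSup_iff.1 hlt
    have hββ' : β < β' := (ENNReal.ofReal_lt_ofReal_iff hβ').1 hlt'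
    exact (measure_univ_ne_top_iff hHpos.le h0 h1 h hβ hν hfin).2
      (Or.inr (summable_tail_of_lt hD hβ hββ' (hP β hβ) (hrec β' hβ' hβc').1 hs))
  · intro β hlt hltc ν hne _ hfin hν
    have hβ : 0 < β := ENNReal.ofReal_pos.1 (lt_of_le_of_lt zero_le hlt)
    by_contra hfinite
    rcases (measure_univ_ne_top_iff hHpos.le h0 h1 h hβ hν hfin).1 hfinite with hz | hs
    · exact hne hz
    · exact hlt.not_ge (le_sSup ⟨β, hβ, hltc, hs, rfl⟩)

end CMS
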